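/- Let n, s ∈ ℕ, N = 2^n, and let γ be product weights, i.e. γ_u = ∏_{j∈u} γ_j for strictly positive reals (γ_j)_{j≥1}. If the generating vector z = (z_1,…,z_s) ∈ ℤ_N^s is constructed by the CBC-DBD algorithm, then H_{s,n,γ}(z) ≤ N·[−1 + ∏_{j=1}^{s}(1 + γ_j log 4)]. -/

import Mathlib

open Finset MeasureTheory

noncomputable section

/-- `lsin a = log (1 / sin² (π a))`. -/
def lsin (a : ℝ) : ℝ := Real.log (1 / Real.sin (Real.pi * a) ^ 2)

/-- The support of `m ∈ ℤ^s`, viewed as a subset of `{1,…,s} ⊂ ℕ`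
(component `j : Fin s` corresponds to the index `j+1 ∈ {1,…,s}`). -/
def msupp {s : ℕ} (m : Fin s → ℤ) : Finset ℕ :=
  (Finset.univ.filter fun j => m j ≠ 0).image fun j : Fin s => (j : ℕ) + 1

/-- `r_{α,γ}(m) = γ_{supp(m)}⁻¹ ∏_{j ∈ supp(m)} |m_j|^α`. -/
def rweight {s : ℕ} (α : ℝ) (γ : Finset ℕ → ℝ) (m : Fin s → ℤ) : ℝ :=
  (γ (msupp m))⁻¹ * ∏ j ∈ Finset.univ.filter (fun j => m j ≠ 0), |(m j : ℝ)| ^ α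

/-- The truncated quantity
`T_{α,γ}(N,z) = ∑_{m ∈ M_{N,s}\{0}, m·z ≡ 0 (mod N)} 1 / r_{α,γ}(m)`,
where `M_{N,s} = {-(N-1),…,N-1}^s` and the components of `z` are `z 1, …, z s`. -/
def Tsum (α : ℝ) (γ : Finset ℕ → ℝ) (N s : ℕ) (z : ℕ → ℤ) : ℝ :=
  ∑ m ∈ (Fintype.piFinset fun _ : Fin s => Finset.Icc (-(N : ℤ) + 1) ((N : ℤ) - 1)).filter
      (fun m => m ≠ 0 ∧ (∑ j : Fin s, m j * z ((j : ℕ) + 1)) % (N : ℤ) = 0),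
    1 / rweight α γ m

/-- `H_{s,n,γ}(z) = ∑_{k=1}^{2^n-1} ∑_{∅≠u⊆{1,…,s}} γ_u ∏_{j∈u} log(1/sin²(π k z_j/2^n))`. -/
def Hsum (γ : Finset ℕ → ℝ) (s n : ℕ) (z : ℕ → ℤ) : ℝ :=
  ∑ k ∈ Finset.Icc (1:ℕ) (2 ^ n - 1),
    ∑ u ∈ (Finset.Icc 1 s).powerset.filter (· ≠ ∅),
      γ u * ∏ j ∈ u, lsin ((k : ℝ) * (z j : ℝ) / 2 ^ n)

/-- The digit-wise quality function `h_{r,n,v,γ}(x)` (with previously chosen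
components `z 1, …, z (r-1)`). -/
def hqual (γ : Finset ℕ → ℝ) (n v r : ℕ) (z : ℕ → ℤ) (x : ℤ) : ℝ :=
  ∑ t ∈ Finset.Icc v n, (1 / 2 ^ (t - v) : ℝ) *
    ∑ k ∈ (Finset.Icc (1:ℕ) (2 ^ t - 1)).filter (fun k => Odd k),
      ((∑ u ∈ (Finset.Icc 1 (r - 1)).powerset.filter (· ≠ ∅),
          γ u * ∏ j ∈ u, lsin ((k : ℝ) * (z j : ℝ) / 2 ^ t)) +
        ∑ u ∈ (Finset.Icc 1 (r - 1)).powerset,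
          γ (u ∪ {r}) * lsin ((k : ℝ) * (x : ℝ) / 2 ^ v) *
            ∏ j ∈ u, lsin ((k : ℝ) * (z j : ℝ) / 2 ^ t))

/-- `z = (z 1, …, z s)` is (a possible) output of the component-by-component
digit-by-digit construction (Algorithm 1) with inputs `n`, `s` and weights `γ`:
`z 1 = 1`, and for `r = 2,…,s` one has `z_{r,1} = 1` and for `v = 2,…,n`,
`z_{r,v} = z_{r,v-1} + z* 2^{v-1}` where `z* ∈ {0,1}` minimizes
`z ↦ h_{r,n,v,γ}(z_{r,v-1} + z 2^{v-1})`; finally `z r = z_{r,n}`. -/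
def IsCBCDBD (γ : Finset ℕ → ℝ) (n s : ℕ) (z : ℕ → ℤ) : Prop :=
  z 1 = 1 ∧
  ∃ zz : ℕ → ℕ → ℤ,
    ∀ r ∈ Finset.Icc 2 s, zz r 1 = 1 ∧ z r = zz r n ∧
      ∀ v ∈ Finset.Icc 2 n, ∃ zs ∈ ({0, 1} : Set ℤ),
        zz r v = zz r (v - 1) + zs * 2 ^ (v - 1) ∧
        ∀ w ∈ ({0, 1} : Set ℤ),
          hqual γ n v r z (zz r (v - 1) + zs * 2 ^ (v - 1)) ≤
            hqual γ n v r z (zz r (v - 1) + w * 2 ^ (v - 1))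

/-- The weights `γ ∪ v`, i.e. `(γ ∪ v)_u = γ_{u ∪ v}`. -/
def unionWeights (γ : Finset ℕ → ℝ) (v : Finset ℕ) : Finset ℕ → ℝ :=
  fun u => γ (u ∪ v)

/-- `γ̃_j = max_{v ⊆ {1,…,j-1}} γ_{v ∪ {j}} / γ_v`. -/
def tildeW (γ : Finset ℕ → ℝ) (j : ℕ) : ℝ :=
  (Finset.Icc 1 (j - 1)).powerset.sup' ⟨∅, Finset.empty_mem_powerset _⟩
    fun v => γ (insert j v) / γ v

/-- The unit cube `[0,1]^s`. -/
def cube (s : ℕ) : Set (Fin s → ℝ) := Set.univ.pi fun _ => Set.Icc 0 1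

/-- The Fourier coefficient `f̂(m) = ∫_{[0,1]^s} f(x) e^{-2πi m·x} dx`. -/
def fcoeff (s : ℕ) (f : (Fin s → ℝ) → ℂ) (m : Fin s → ℤ) : ℂ :=
  ∫ x in cube s,
    f x * Complex.exp (-(2 * (Real.pi : ℂ) * Complex.I) * ∑ j, (m j : ℂ) * (x j : ℂ))

/-- The rank-1 lattice rule `Q_{N,s}(f,z) = (1/N) ∑_{k=0}^{N-1} f({k z / N})`. -/
def qmc (N s : ℕ) (z : ℕ → ℤ) (f : (Fin s → ℝ) → ℂ) : ℂ :=
  (N : ℂ)⁻¹ * ∑ k ∈ Finset.range N,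
    f fun j => Int.fract ((k : ℝ) * (z ((j : ℕ) + 1) : ℝ) / (N : ℝ))

/-- The worst-case error `e_{N,s,α,γ}(z)` of the rank-1 lattice rule with generating
vector `z` in the unit ball of the space `E^α_{s,γ}` (whose elements are identified
with their continuous representatives). -/
def wce (N s : ℕ) (α : ℝ) (γ : Finset ℕ → ℝ) (z : ℕ → ℤ) : ℝ :=
  ⨆ f ∈ {f : (Fin s → ℝ) → ℂ |
      Continuous f ∧ ∀ m : Fin s → ℤ, ‖fcoeff s f m‖ * rweight α γ m ≤ 1},
    ‖(∫ x in cube s, f x) - qmc N s z f‖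

/-- For POD weights given by `(Γ_ℓ)` and `(γ_j)`:
`p_{m,ℓ,t}(k) = ∑_{u ⊆ {1,…,m}, |u| = ℓ} Γ_ℓ ∏_{j∈u} γ_j log(1/sin²(π k z_j/2^t))`. -/
def psum (Γ γw : ℕ → ℝ) (z : ℕ → ℤ) (m ℓ t : ℕ) (k : ℕ) : ℝ :=
  ∑ u ∈ (Finset.Icc 1 m).powerset.filter (fun u => u.card = ℓ),
    Γ ℓ * ∏ j ∈ u, γw j * lsin ((k : ℝ) * (z j : ℝ) / 2 ^ t)

lemma lsin_nonneg (a : ℝ) : 0 ≤ lsin a := by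
  unfold lsin
  rcases eq_or_ne (Real.sin (Real.pi * a)) 0 with h | h
  · simp [h]
  · apply Real.log_nonneg
    rw [le_div_iff₀ (by positivity), one_mul]
    exact Real.sin_sq_le_one _

lemma lsin_add_int (a : ℝ) (m : ℤ) : lsin (a + m) = lsin a := by
  unfold lsin
  have : Real.pi * (a + m) = Real.pi * a + m * Real.pi := by ring
  rw [this, Real.sin_add_int_mul_pi, mul_pow]
  have h : ((-1 : ℝ) ^ m) ^ 2 = 1 := by
    rw [← zpow_natCast, ← zpow_mul, mul_comm, zpow_mul]; simp
  rw [h, one_mul]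

lemma lsin_zero : lsin 0 = 0 := by simp [lsin]

lemma lsin_half : lsin (1 / 2) = 0 := by
  unfold lsin
  have : Real.pi * (1 / 2) = Real.pi / 2 := by ring
  rw [this]; simp

lemma lsin_odd_half (k : ℕ) (hk : Odd k) : lsin ((k : ℝ) / 2) = 0 := by
  obtain ⟨m, rfl⟩ := hk
  have := lsin_add_int (1 / 2) m
  rw [lsin_half] at this
  rw [← this]; congr 1; push_cast; ring

lemma lsin_dup (a : ℝ) : lsin a + lsin (a + 1 / 2) ≤ Real.log 4 + lsin (2 * a) := by
  unfold lsin
  have h1 : Real.pi * (a + 1 / 2) = Real.pi * a + Real.pi / 2 := by ring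
  have h2 : Real.pi * (2 * a) = 2 * (Real.pi * a) := by ring
  rw [h1, h2, Real.sin_add_pi_div_two, Real.sin_two_mul]
  have hsc := Real.sin_sq_add_cos_sq (Real.pi * a)
  have h4 : 0 ≤ Real.log 4 := Real.log_nonneg (by norm_num)
  rcases eq_or_ne (Real.sin (Real.pi * a)) 0 with hs | hs
  · rw [hs] at hsc ⊢
    have : Real.cos (Real.pi * a) ^ 2 = 1 := by linarith
    rw [this]; simpa using h4
  rcases eq_or_ne (Real.cos (Real.pi * a)) 0 with hc | hc
  · rw [hc] at hsc ⊢
    have : Real.sin (Real.pi * a) ^ 2 = 1 := by linarith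
    rw [this]; simpa using h4
  rw [← Real.log_mul (by positivity) (by positivity), ← Real.log_mul (by positivity) (by positivity)]
  apply le_of_eq; congr 1; field_simp; norm_num

lemma lsin_base (n : ℕ) :
    ∑ k ∈ range (2 ^ n), lsin ((k : ℝ) / 2 ^ n) ≤ (2 ^ n - 1) * Real.log 4 := by
  induction n with
  | zero => simp [lsin_zero]
  | succ n ih =>
    have e : (2 : ℕ) ^ (n + 1) = 2 ^ n + 2 ^ n := by ring
    rw [e, sum_range_add, ← sum_add_distrib]
    have : ∀ k ∈ range (2 ^ n), lsin ((k : ℝ) / 2 ^ (n + 1)) +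
        lsin (((2 ^ n + k : ℕ) : ℝ) / 2 ^ (n + 1)) ≤ Real.log 4 + lsin ((k : ℝ) / 2 ^ n) := by
      intro k _
      have := lsin_dup ((k : ℝ) / 2 ^ (n + 1))
      have e1 : (k : ℝ) / 2 ^ (n + 1) + 1 / 2 = ((2 ^ n + k : ℕ) : ℝ) / 2 ^ (n + 1) := by
        push_cast; field_simp; ring
      have e2 : 2 * ((k : ℝ) / 2 ^ (n + 1)) = (k : ℝ) / 2 ^ n := by field_simp; ring
      rwa [e1, e2] at this
    refine (sum_le_sum this).trans ?_
    rw [sum_add_distrib]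
    simp only [sum_const, card_range, nsmul_eq_mul]
    push_cast
    rw [pow_succ]; linarith

def oddk (t : ℕ) : Finset ℕ := (Finset.Icc (1:ℕ) (2 ^ t - 1)).filter (fun k => Odd k)

lemma reindex (f : ℝ → ℝ) (n : ℕ) :
    ∑ k ∈ Finset.Icc (1:ℕ) (2 ^ n - 1), f ((k : ℝ) / 2 ^ n) =
      ∑ t ∈ Finset.Icc 1 n, ∑ k ∈ oddk t, f ((k : ℝ) / 2 ^ t) := by
  induction n with
  | zero => simp
  | succ n ih =>
    rw [sum_Icc_succ_top (by omega), ← ih,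
      ← sum_filter_add_sum_filter_not (Finset.Icc (1:ℕ) (2 ^ (n+1) - 1)) (fun k => Odd k), add_comm]
    congr 1
    symm
    apply sum_bij (fun k _ => 2 * k)
    · intro k hk
      simp only [Finset.mem_Icc, mem_filter, Nat.not_odd_iff_even] at *
      refine ⟨?_, by simp⟩
      rw [pow_succ]; omega
    · intro a _ b _ h; simpa using h
    · intro b hb
      simp only [Finset.mem_Icc, mem_filter, Nat.not_odd_iff_even] at hb
      obtain ⟨⟨h1, h2⟩, c, rfl⟩ := hb
      rw [pow_succ] at h2
      refine ⟨c, ?_, by ring⟩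
      simp only [Finset.mem_Icc]; omega
    · intro k _
      congr 1; push_cast; field_simp; ring

def Sq (P : ℕ → ℕ → ℝ) (n v : ℕ) (x : ℤ) : ℝ :=
  ∑ t ∈ Finset.Icc v n, (1 / 2 ^ (t - v) : ℝ) *
    ∑ k ∈ oddk t, P t k * lsin ((k : ℝ) * (x : ℝ) / 2 ^ v)

def Wq (P : ℕ → ℕ → ℝ) (n v : ℕ) : ℝ :=
  ∑ t ∈ Finset.Icc v n, (1 / 2 ^ (t - v) : ℝ) * ∑ k ∈ oddk t, P t k

lemma split_left (g : ℕ → ℝ) (m n : ℕ) (h : m ≤ n) :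
    ∑ t ∈ Finset.Icc m n, (1 / 2 ^ (t - m) : ℝ) * g t =
      g m + (1 / 2) * ∑ t ∈ Finset.Icc (m + 1) n, (1 / 2 ^ (t - (m + 1)) : ℝ) * g t := by
  rw [← Finset.insert_Icc_add_one_left_eq_Icc h, sum_insert (by simp), mul_sum]
  congr 1
  · simp
  · apply sum_congr rfl
    intro t ht
    simp only [Finset.mem_Icc] at ht
    have : t - m = (t - (m + 1)) + 1 := by omega
    rw [this, pow_succ]; field_simp

lemma Sq_avg (P : ℕ → ℕ → ℝ) (hP : ∀ t k, 0 ≤ P t k) (n m : ℕ) (x : ℤ) (hm : m ≤ n) :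
    Sq P n (m + 1) x + Sq P n (m + 1) (x + 2 ^ m) ≤
      Real.log 4 * Wq P n (m + 1) +
        2 * (Sq P n m x - ∑ k ∈ oddk m, P m k * lsin ((k : ℝ) * (x : ℝ) / 2 ^ m)) := by
  have h := split_left (fun t => ∑ k ∈ oddk t, P t k * lsin ((k : ℝ) * (x : ℝ) / 2 ^ m)) m n hm
  have h' : 2 * (Sq P n m x - ∑ k ∈ oddk m, P m k * lsin ((k : ℝ) * (x : ℝ) / 2 ^ m)) =
    ∑ t ∈ Finset.Icc (m + 1) n, (1 / 2 ^ (t - (m + 1)) : ℝ) *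
      ∑ k ∈ oddk t, P t k * lsin ((k : ℝ) * (x : ℝ) / 2 ^ m) := by
    unfold Sq; rw [h]; ring
  rw [h']
  unfold Sq Wq
  rw [mul_sum, ← sum_add_distrib, ← sum_add_distrib]
  apply sum_le_sum
  intro t ht
  rw [mul_left_comm, ← mul_add, ← mul_add]
  apply mul_le_mul_of_nonneg_left _ (by positivity)
  rw [mul_sum, ← sum_add_distrib, ← sum_add_distrib]
  apply sum_le_sum
  intro k hk
  rw [mul_comm (Real.log 4), ← mul_add, ← mul_add]
  apply mul_le_mul_of_nonneg_left _ (hP t k)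
  simp only [oddk, mem_filter] at hk
  obtain ⟨c, hc⟩ := hk.2
  have hd := lsin_dup ((k : ℝ) * (x : ℝ) / 2 ^ (m + 1))
  rw [← lsin_add_int ((k : ℝ) * (x : ℝ) / 2 ^ (m + 1) + 1 / 2) c] at hd
  have e1 : (k : ℝ) * (x : ℝ) / 2 ^ (m + 1) + 1 / 2 + ((c : ℤ) : ℝ) =
      (k : ℝ) * ((x + 2 ^ m : ℤ) : ℝ) / 2 ^ (m + 1) := by
    rw [hc]; push_cast; field_simp; ring
  have e2 : 2 * ((k : ℝ) * (x : ℝ) / 2 ^ (m + 1)) = (k : ℝ) * (x : ℝ) / 2 ^ m := by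
    field_simp; ring
  rwa [e1, e2] at hd

lemma key (P : ℕ → ℕ → ℝ) (hP : ∀ t k, 0 ≤ P t k) (n : ℕ) (hn : 1 ≤ n) (y : ℕ → ℤ)
    (y1 : y 1 = 1)
    (hy : ∀ v ∈ Finset.Icc 2 n, ∃ zs ∈ ({0, 1} : Set ℤ),
        y v = y (v - 1) + zs * 2 ^ (v - 1) ∧
        ∀ w ∈ ({0, 1} : Set ℤ),
          Sq P n v (y (v - 1) + zs * 2 ^ (v - 1)) ≤ Sq P n v (y (v - 1) + w * 2 ^ (v - 1))) :
    ∑ t ∈ Finset.Icc 1 n, ∑ k ∈ oddk t, P t k * lsin ((k : ℝ) * (y n : ℝ) / 2 ^ t) ≤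
      Real.log 4 * ∑ t ∈ Finset.Icc 1 n, ∑ k ∈ oddk t, P t k := by
  have h4 : 0 ≤ Real.log 4 := Real.log_nonneg (by norm_num)
  set A : ℕ → ℝ := fun t => ∑ k ∈ oddk t, P t k * lsin ((k : ℝ) * (y t : ℝ) / 2 ^ t) with hA
  set Q : ℕ → ℝ := fun t => ∑ k ∈ oddk t, P t k with hQ
  have claim : ∀ m, m + 1 ≤ n → ∑ t ∈ Finset.Icc 1 m, A t + Sq P n (m + 1) (y (m + 1)) ≤
      Real.log 4 * (∑ t ∈ Finset.Icc 1 m, Q t + Wq P n (m + 1)) := by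
    intro m
    induction m with
    | zero =>
      intro _
      have hS : Sq P n 1 1 = 0 := by
        unfold Sq
        apply sum_eq_zero
        intro t _
        rw [sum_eq_zero, mul_zero]
        intro k hk
        simp only [oddk, mem_filter] at hk
        have := lsin_odd_half k hk.2
        simp [this]
      have hW : 0 ≤ Wq P n 1 := by
        unfold Wq
        exact sum_nonneg fun t _ => mul_nonneg (by positivity) (sum_nonneg fun k _ => hP t k)
      simp only [zero_add, y1, hS]
      simp only [show Finset.Icc 1 0 = (∅ : Finset ℕ) by rfl, sum_empty, zero_add]
      positivity
    | succ m ih =>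
      intro hm
      have ih := ih (by omega)
      obtain ⟨zs, _, h1, h2⟩ := hy (m + 2) (by simp; omega)
      simp only [show m + 2 - 1 = m + 1 by omega] at h1 h2
      rw [← h1] at h2
      have a0 := h2 0 (by simp)
      have a1 := h2 1 (by simp)
      simp only [zero_mul, add_zero, one_mul] at a0 a1
      have av := Sq_avg P hP n (m + 1) (y (m + 1)) (by omega)
      have hW : Wq P n (m + 1) = Q (m + 1) + 1 / 2 * Wq P n (m + 1 + 1) :=
        split_left Q (m + 1) n (by omega)
      rw [sum_Icc_succ_top (by omega), sum_Icc_succ_top (by omega)]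
      rw [hW] at ih
      have : A (m + 1) = ∑ k ∈ oddk (m + 1), P (m + 1) k * lsin ((k : ℝ) * (y (m + 1) : ℝ) / 2 ^ (m + 1)) := rfl
      rw [← this] at av
      show _ + Sq P n (m + 2) (y (m + 2)) ≤ _
      linarith
  obtain ⟨m, rfl⟩ : ∃ m, n = m + 1 := ⟨n - 1, by omega⟩
  have c := claim m le_rfl
  have hS : Sq P (m + 1) (m + 1) (y (m + 1)) = A (m + 1) := by simp [Sq, hA]
  have hW : Wq P (m + 1) (m + 1) = Q (m + 1) := by simp [Wq, hQ]
  rw [hS, hW, ← sum_Icc_succ_top (by omega), ← sum_Icc_succ_top (by omega)] at c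
  refine le_trans (le_of_eq ?_) c
  have cong : ∀ d t, 1 ≤ t → t + d ≤ m + 1 → ∃ q : ℤ, y (t + d) = y t + q * 2 ^ t := by
    intro d
    induction d with
    | zero => intro t _ _; exact ⟨0, by simp⟩
    | succ d ih =>
      intro t ht htd
      obtain ⟨q, hq⟩ := ih t ht (by omega)
      obtain ⟨zs, _, h1, _⟩ := hy (t + d + 1) (by simp; omega)
      refine ⟨q + zs * 2 ^ d, ?_⟩
      rw [← add_assoc, h1, Nat.add_sub_cancel, hq, pow_add]; ring
  apply sum_congr rfl
  intro t ht
  apply sum_congr rfl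
  intro k _
  simp only [Finset.mem_Icc] at ht
  obtain ⟨q, hq⟩ := cong (m + 1 - t) t ht.1 (by omega)
  rw [show t + (m + 1 - t) = m + 1 by omega] at hq
  congr 1
  rw [hq, ← lsin_add_int ((k : ℝ) * (y t : ℝ) / 2 ^ t) (k * q)]
  congr 1; push_cast; field_simp

lemma sum_ps (γ : Finset ℕ → ℝ) (γw : ℕ → ℝ) (hprod : ∀ u : Finset ℕ, γ u = ∏ j ∈ u, γw j)
    (g : ℕ → ℝ) (S : Finset ℕ) :
    ∑ u ∈ S.powerset, γ u * ∏ j ∈ u, g j = ∏ j ∈ S, (1 + γw j * g j) := by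
  rw [Finset.prod_one_add]
  apply sum_congr rfl
  intro u _
  rw [hprod, prod_mul_distrib]

lemma sum_ps_ne (γ : Finset ℕ → ℝ) (γw : ℕ → ℝ) (hprod : ∀ u : Finset ℕ, γ u = ∏ j ∈ u, γw j)
    (g : ℕ → ℝ) (S : Finset ℕ) :
    ∑ u ∈ S.powerset.filter (· ≠ ∅), γ u * ∏ j ∈ u, g j = ∏ j ∈ S, (1 + γw j * g j) - 1 := by
  rw [← sum_ps γ γw hprod, Finset.filter_ne', eq_sub_iff_add_eq]
  have := Finset.sum_erase_add S.powerset (fun u => γ u * ∏ j ∈ u, g j) (Finset.empty_mem_powerset S)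
  simpa [hprod ∅] using this

def Pq (γw : ℕ → ℝ) (z : ℕ → ℤ) (r t k : ℕ) : ℝ :=
  ∏ j ∈ Finset.Icc 1 r, (1 + γw j * lsin ((k : ℝ) * (z j : ℝ) / 2 ^ t))

lemma Pq_nonneg (γw : ℕ → ℝ) (hγw : ∀ j, 0 < γw j) (z : ℕ → ℤ) (r t k : ℕ) :
    0 ≤ Pq γw z r t k :=
  prod_nonneg fun j _ => add_nonneg zero_le_one (mul_nonneg (hγw j).le (lsin_nonneg _))

lemma hqual_eq (γ : Finset ℕ → ℝ) (γw : ℕ → ℝ) (hprod : ∀ u : Finset ℕ, γ u = ∏ j ∈ u, γw j)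
    (n v r : ℕ) (hr : 1 ≤ r) (z : ℕ → ℤ) (x : ℤ) :
    hqual γ n v r z x = (∑ t ∈ Finset.Icc v n, (1 / 2 ^ (t - v) : ℝ) *
      ∑ k ∈ oddk t, (Pq γw z (r - 1) t k - 1)) + γw r * Sq (Pq γw z (r - 1)) n v x := by
  unfold hqual Sq
  rw [mul_sum, ← sum_add_distrib]
  apply sum_congr rfl
  intro t _
  rw [mul_left_comm, ← mul_add]
  congr 1
  rw [mul_sum, ← sum_add_distrib]
  apply sum_congr rfl
  intro k _
  rw [sum_ps_ne γ γw hprod]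
  congr 1
  unfold Pq
  rw [← sum_ps γ γw hprod, sum_mul, mul_sum]
  apply sum_congr rfl
  intro u hu
  have hru : r ∉ u := by
    intro h
    have := Finset.mem_powerset.1 hu h
    simp only [Finset.mem_Icc] at this; omega
  rw [hprod (u ∪ {r}), hprod u, prod_union (by simpa using hru), prod_singleton]
  ring

lemma Dsum (γw : ℕ → ℝ) (z : ℕ → ℤ) (r n : ℕ) :
    ∑ k ∈ Finset.Icc (1:ℕ) (2 ^ n - 1), Pq γw z r n k =
      ∑ t ∈ Finset.Icc 1 n, ∑ k ∈ oddk t, Pq γw z r t k := by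
  have := reindex (fun a => ∏ j ∈ Finset.Icc 1 r, (1 + γw j * lsin (a * (z j : ℝ)))) n
  simpa only [Pq, div_mul_eq_mul_div] using this

lemma Pq_succ (γw : ℕ → ℝ) (z : ℕ → ℤ) (r t k : ℕ) :
    Pq γw z (r + 1) t k = Pq γw z r t k +
      γw (r + 1) * (Pq γw z r t k * lsin ((k : ℝ) * (z (r + 1) : ℝ) / 2 ^ t)) := by
  unfold Pq
  rw [prod_Icc_succ_top (by omega)]; ring

lemma Dbound (n s : ℕ) (hn : 1 ≤ n)
    (γ : Finset ℕ → ℝ) (γw : ℕ → ℝ) (hγw : ∀ j, 0 < γw j)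
    (hprod : ∀ u : Finset ℕ, γ u = ∏ j ∈ u, γw j)
    (z : ℕ → ℤ) (hz : IsCBCDBD γ n s z) (r : ℕ) (hr : r + 1 ≤ s) :
    ∑ k ∈ Finset.Icc (1:ℕ) (2 ^ n - 1), Pq γw z (r + 1) n k ≤
      (2 ^ n - 1) * ∏ j ∈ Finset.Icc 1 (r + 1), (1 + γw j * Real.log 4) := by
  have h4 : 0 ≤ Real.log 4 := Real.log_nonneg (by norm_num)
  obtain ⟨z1, zz, hzz⟩ := hz
  induction r with
  | zero =>
    have hb := lsin_base n
    have e : range (2 ^ n) = insert 0 (Finset.Icc 1 (2 ^ n - 1)) := by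
      ext k
      have : 0 < 2 ^ n := by positivity
      simp only [Finset.mem_range, Finset.mem_insert, Finset.mem_Icc]; omega
    rw [e, sum_insert (by simp)] at hb
    simp only [Nat.cast_zero, zero_div, lsin_zero, zero_add] at hb
    have e2 : ∀ k, Pq γw z (0 + 1) n k = 1 + γw 1 * lsin ((k : ℝ) / 2 ^ n) := by
      intro k; simp [Pq, z1]
    simp only [e2]
    rw [sum_add_distrib, ← mul_sum]
    simp only [sum_const, Nat.card_Icc, nsmul_eq_mul, zero_add, Finset.Icc_self, prod_singleton]
    have := mul_le_mul_of_nonneg_left hb (hγw 1).le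
    rw [Nat.add_sub_cancel, Nat.cast_sub Nat.one_le_two_pow]
    push_cast
    linarith
  | succ r ih =>
    have ih := ih (by omega)
    obtain ⟨h1, h2, h3⟩ := hzz (r + 2) (by simp; omega)
    have hk := key (Pq γw z (r + 1)) (Pq_nonneg γw hγw z (r + 1)) n hn (zz (r + 2)) h1 (by
      intro v hv
      obtain ⟨zs, a, b, c⟩ := h3 v hv
      refine ⟨zs, a, b, fun w hw => ?_⟩
      have := c w hw
      rw [hqual_eq γ γw hprod _ _ _ (by omega), hqual_eq γ γw hprod _ _ _ (by omega)] at this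
      exact le_of_mul_le_mul_left (le_of_add_le_add_left this) (hγw (r + 2)))
    rw [← h2] at hk
    rw [Dsum] at ih ⊢
    simp only [Pq_succ γw z (r + 1), sum_add_distrib, ← mul_sum]
    rw [prod_Icc_succ_top (by omega)]
    have g := hγw (r + 1 + 1)
    have hk' := mul_le_mul_of_nonneg_left hk g.le
    have ih' := mul_le_mul_of_nonneg_right ih
      (show 0 ≤ 1 + γw (r + 1 + 1) * Real.log 4 by positivity)
    show _ + γw (r + 1 + 1) * (∑ t ∈ Finset.Icc 1 n, ∑ k ∈ oddk t, Pq γw z (r + 1) t k * lsin ((k : ℝ) * (z (r + 2) : ℝ) / 2 ^ t)) ≤ _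
    linarith

/-- Theorem 4: for product weights `γ_u = ∏_{j∈u} γ_j` and `z ∈ ℤ_N^s`,
`N = 2^n`, constructed by the CBC-DBD algorithm,
`H_{s,n,γ}(z) ≤ N(-1 + ∏_{j=1}^s (1 + γ_j log 4))`. -/
theorem statement3 (n s : ℕ) (hn : 1 ≤ n) (hs : 1 ≤ s)
    (γ : Finset ℕ → ℝ) (γw : ℕ → ℝ) (hγw : ∀ j, 0 < γw j)
    (hprod : ∀ u : Finset ℕ, γ u = ∏ j ∈ u, γw j)
    (z : ℕ → ℤ) (hz : IsCBCDBD γ n s z) :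
    Hsum γ s n z ≤ 2 ^ n * (-1 + ∏ j ∈ Finset.Icc 1 s, (1 + γw j * Real.log 4)) := by
  obtain ⟨r, rfl⟩ : ∃ r, s = r + 1 := ⟨s - 1, by omega⟩
  have hD := Dbound n (r + 1) hn γ γw hγw hprod z hz r le_rfl
  have h4 : 0 ≤ Real.log 4 := Real.log_nonneg (by norm_num)
  have hge : 1 ≤ ∏ j ∈ Finset.Icc 1 (r + 1), (1 + γw j * Real.log 4) := by
    have h0 := Finset.prod_le_prod (s := Finset.Icc 1 (r + 1)) (f := fun _ => (1 : ℝ))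
      (g := fun j => 1 + γw j * Real.log 4) (fun _ _ => zero_le_one)
      (fun j _ => le_add_of_nonneg_right (mul_nonneg (hγw j).le h4))
    simpa using h0
  unfold Hsum
  have e : ∀ k ∈ Finset.Icc (1:ℕ) (2 ^ n - 1),
      ∑ u ∈ (Finset.Icc 1 (r + 1)).powerset.filter (· ≠ ∅),
      γ u * ∏ j ∈ u, lsin ((k : ℝ) * (z j : ℝ) / 2 ^ n) = Pq γw z (r + 1) n k - 1 :=
    fun k _ => sum_ps_ne γ γw hprod _ _
  rw [sum_congr rfl e, sum_sub_distrib]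
  simp only [sum_const, Nat.card_Icc, nsmul_eq_mul]
  rw [Nat.add_sub_cancel, Nat.cast_sub Nat.one_le_two_pow]
  push_cast
  linarith

end
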